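/- arXiv:2003.01027 — 2 statements merged into one kernel-verified Lean document; each statement's English description precedes it below -/
import Mathlib

section
/- Let β ∈ (0,1). For every t > 0, the Mittag-Leffler density admits the spectral representation f_β(t) = ∫_0^∞ θ e^{-θt} K_β(θ) dθ, where f_β(t) = t^{β-1} E_{β,β}(-t^β) and K_β(θ) = (1/π) · θ^{β-1} sin(βπ) / (θ^{2β} + 2 θ^β cos(βπ) + 1). -/
open MeasureTheory Set Filter

/-- The two-parameter Mittag-Leffler function `E_{γ,δ}(z) = ∑ zⁿ / Γ(nγ + δ)`. -/
noncomputable def ML2 (γ δ z : ℝ) : ℝ := ∑' n : ℕ, z ^ n / Real.Gamma (n * γ + δ)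

/-- The one-parameter Mittag-Leffler function `E_β(z) = E_{β,1}(z)`. -/
noncomputable def ML (β z : ℝ) : ℝ := ML2 β 1 z

/-- The Mittag-Leffler density `f_β(t) = t^{β-1} E_{β,β}(-t^β)`. -/
noncomputable def fML (β t : ℝ) : ℝ := t ^ (β - 1) * ML2 β β (-(t ^ β))

/-- The spectral kernel `K_β(θ)`. -/
noncomputable def Kspec (β θ : ℝ) : ℝ :=
  (1 / Real.pi) * (θ ^ (β - 1) * Real.sin (β * Real.pi)) /
    (θ ^ (2 * β) + 2 * θ ^ β * Real.cos (β * Real.pi) + 1)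


lemma ml_chg {E : Type*} [NormedAddCommGroup E] [NormedSpace ℝ E] (g : ℝ → E) :
    ∫ u : ℝ, Real.exp u • g (Real.exp u) = ∫ x in Ioi (0:ℝ), g x := by
  have h := integral_image_eq_integral_abs_deriv_smul (s := univ) (f := Real.exp)
    (f' := Real.exp) MeasurableSet.univ
    (fun x _ => (Real.hasDerivAt_exp x).hasDerivWithinAt) Real.exp_injective.injOn g
  rw [image_univ, Real.range_exp] at h
  rw [h]
  simp

lemma ml_chg_int {E : Type*} [NormedAddCommGroup E] [NormedSpace ℝ E] (g : ℝ → E) :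
    IntegrableOn g (Ioi 0) ↔ Integrable (fun u : ℝ => Real.exp u • g (Real.exp u)) := by
  have h := integrableOn_image_iff_integrableOn_abs_deriv_smul (s := univ) (f := Real.exp)
    (f' := Real.exp) MeasurableSet.univ
    (fun x _ => (Real.hasDerivAt_exp x).hasDerivWithinAt) Real.exp_injective.injOn g
  rw [image_univ, Real.range_exp] at h
  rw [h]
  simp

lemma ml_aux (c t u : ℝ) : Real.exp u • ((Real.exp u) ^ (c - 1) * Real.exp (-(t * Real.exp u)))
    = Real.exp (c * u - t * Real.exp u) := by
  rw [← Real.exp_mul, smul_eq_mul, ← Real.exp_add, ← Real.exp_add]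
  congr 1; ring

lemma ml_gamma {c t : ℝ} (hc : 0 < c) (ht : 0 < t) :
    ∫ u : ℝ, Real.exp (c * u - t * Real.exp u) = (1 / t) ^ c * Real.Gamma c := by
  rw [← Real.integral_rpow_mul_exp_neg_mul_Ioi hc ht, ← ml_chg]
  simp_rw [ml_aux]

lemma ml_gint {c t : ℝ} (hc : 0 < c) (ht : 0 < t) :
    Integrable (fun u : ℝ => Real.exp (c * u - t * Real.exp u)) := by
  apply Integrable.of_integral_ne_zero
  rw [ml_gamma hc ht]
  have := Real.Gamma_pos_of_pos hc
  positivity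

lemma ml_gint1 (c : ℝ) {t : ℝ} (ht : 0 < t) :
    IntegrableOn (fun u : ℝ => Real.exp (c * u - t * Real.exp u)) (Ioi 1) := by
  have h := (ml_gint (c := |c| + 1) (by positivity) ht).integrableOn (s := Ioi 1)
  refine Integrable.mono' h (by fun_prop) ?_
  refine (ae_restrict_iff' measurableSet_Ioi).mpr (ae_of_all _ fun u hu => ?_)
  have hu : (1:ℝ) < u := hu
  rw [Real.norm_eq_abs, Real.abs_exp]
  apply Real.exp_le_exp.mpr
  nlinarith [le_abs_self c]

lemma ml_glim (c : ℝ) {t : ℝ} (ht : 0 < t) :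
    Tendsto (fun u : ℝ => Real.exp (c * u - t * Real.exp u)) atTop (nhds 0) := by
  have h := (tendsto_rpow_mul_exp_neg_mul_atTop_nhds_zero c t ht).comp Real.tendsto_exp_atTop
  refine h.congr fun u => ?_
  simp only [Function.comp]
  rw [← Real.exp_mul, ← Real.exp_add]
  congr 1; ring

/-- Hankel-type functional in logarithmic coordinates. -/
noncomputable def mlHk (W : ℂ → ℂ) : ℂ :=
  Complex.I * (∫ φ in (-Real.pi)..Real.pi, W ((1:ℝ) + φ * Complex.I)) +
    ∫ u in Ioi (1:ℝ), (W (u + (Real.pi:ℝ) * Complex.I) - W (u + (-Real.pi : ℝ) * Complex.I))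

lemma ml_shift (W : ℂ → ℂ) (hW : ∀ w : ℂ, |w.im| ≤ Real.pi → DifferentiableAt ℂ W w) (c : ℂ)
    (g : ℝ → ℝ) (hg : Tendsto g atBot (nhds 0))
    (hb : ∀ᶠ u : ℝ in atBot, ∀ φ : ℝ, ‖W (u + φ * Complex.I) - c‖ ≤ g u)
    (hD : Integrable (fun u : ℝ => W (u + (Real.pi:ℝ) * Complex.I) -
      W (u + (-Real.pi : ℝ) * Complex.I))) :
    mlHk W = 2 * Real.pi * Complex.I * c + ∫ u : ℝ, (W (u + (Real.pi:ℝ) * Complex.I) -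
      W (u + (-Real.pi : ℝ) * Complex.I)) := by
  have hpi := Real.pi_pos
  have hcontL : ∀ y : ℝ, |y| ≤ Real.pi → Continuous (fun u : ℝ => W (u + y * Complex.I)) := by
    intro y hy
    rw [continuous_iff_continuousAt]
    intro u
    refine ContinuousAt.comp (g := W) (f := fun u : ℝ => (u:ℂ) + y * Complex.I)
      (hW _ (by simpa using hy)).continuousAt ?_
    fun_prop
  have hcontV : ∀ u : ℝ, ContinuousOn (fun φ : ℝ => W (u + φ * Complex.I))
      (uIcc (-Real.pi) Real.pi) := by
    intro u φ hφ
    rw [uIcc_of_le (by linarith)] at hφ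
    refine ContinuousAt.continuousWithinAt ?_
    refine ContinuousAt.comp (g := W) (f := fun φ : ℝ => (u:ℂ) + φ * Complex.I)
      (hW _ (by simpa using abs_le.mpr hφ)).continuousAt ?_
    fun_prop
  have hrect : ∀ u0 : ℝ, Complex.I * (∫ φ in (-Real.pi)..Real.pi, W ((1:ℝ) + φ * Complex.I)) =
      (∫ u in u0..1, (W (u + (Real.pi:ℝ) * Complex.I) - W (u + (-Real.pi : ℝ) * Complex.I))) +
      Complex.I * (∫ φ in (-Real.pi)..Real.pi, W (u0 + φ * Complex.I)) := by
    intro u0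
    have := Complex.integral_boundary_rect_eq_zero_of_differentiableOn W
      (u0 + (-Real.pi : ℝ) * Complex.I) ((1:ℝ) + (Real.pi : ℝ) * Complex.I) (by
        intro w hw
        refine (hW w ?_).differentiableWithinAt
        have := (Complex.mem_reProdIm.mp hw).2
        simp only [Complex.add_im, Complex.ofReal_im, Complex.mul_im, Complex.ofReal_re,
          Complex.I_im, Complex.I_re, mul_one, mul_zero, zero_add, add_zero] at this
        rw [uIcc_of_le (by linarith)] at this
        exact abs_le.mpr this)
    simp only [Complex.add_im, Complex.ofReal_im, Complex.mul_im, Complex.ofReal_re,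
          Complex.I_im, Complex.I_re, mul_one, mul_zero, zero_add, add_zero,
          Complex.add_re, Complex.mul_re, sub_zero, smul_eq_mul] at this
    rw [intervalIntegral.integral_sub]
    · linear_combination this
    · exact (hcontL _ (by rw [abs_of_pos hpi])).intervalIntegrable _ _
    · exact (hcontL _ (by rw [abs_neg, abs_of_pos hpi])).intervalIntegrable _ _
  have hl1 := intervalIntegral_tendsto_integral_Iic (1:ℝ) (hD.integrableOn (s := Iic 1))
    (tendsto_id (x := atBot))
  have hl2 : Tendsto (fun u0 : ℝ => ∫ φ in (-Real.pi)..Real.pi, W (u0 + φ * Complex.I)) atBot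
      (nhds (2 * Real.pi * c)) := by
    rw [tendsto_iff_norm_sub_tendsto_zero]
    have hg2 : Tendsto (fun u => g u * |Real.pi - (-Real.pi)|) atBot (nhds 0) := by
      simpa using hg.mul_const (|Real.pi - (-Real.pi)|)
    refine squeeze_zero' (Eventually.of_forall fun _ => norm_nonneg _) ?_ hg2
    filter_upwards [hb] with u hu
    have e : (∫ φ in (-Real.pi)..Real.pi, W (u + φ * Complex.I)) - 2 * Real.pi * c =
        ∫ φ in (-Real.pi)..Real.pi, (W (u + φ * Complex.I) - c) := by
      rw [intervalIntegral.integral_sub (hcontV u).intervalIntegrable (by simp)]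
      rw [intervalIntegral.integral_const, Complex.real_smul]
      push_cast
      ring
    rw [e]
    exact intervalIntegral.norm_integral_le_of_norm_le_const (fun φ _ => hu φ)
  have hl := (hl1.add (hl2.const_mul Complex.I))
  have hc : Tendsto (fun u0 : ℝ => Complex.I *
      (∫ φ in (-Real.pi)..Real.pi, W ((1:ℝ) + φ * Complex.I))) atBot
      (nhds (Complex.I * (∫ φ in (-Real.pi)..Real.pi, W ((1:ℝ) + φ * Complex.I)))) :=
    tendsto_const_nhds
  have huniq := tendsto_nhds_unique hc (hl.congr fun u0 => (hrect u0).symm)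
  have hsplit := intervalIntegral.integral_Iic_add_Ioi (hD.integrableOn (s := Iic 1))
    (hD.integrableOn (s := Ioi 1))
  unfold mlHk
  rw [huniq, ← hsplit]
  ring

noncomputable def mlV (t s : ℝ) (w : ℂ) : ℂ :=
  Complex.exp ((1 - s) * w + t * Complex.exp w)

lemma ml_exp_pi (u : ℝ) : Complex.exp (u + (Real.pi:ℝ) * Complex.I) = -(Real.exp u : ℝ) := by
  rw [Complex.exp_add, Complex.exp_pi_mul_I]; push_cast; ring

lemma ml_exp_npi (u : ℝ) : Complex.exp (u + (-Real.pi:ℝ) * Complex.I) = -(Real.exp u : ℝ) := by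
  rw [Complex.exp_add, Complex.ofReal_neg, neg_mul, Complex.exp_neg, Complex.exp_pi_mul_I]
  push_cast; norm_num

lemma mlV_pi (t s u : ℝ) : mlV t s (u + (Real.pi:ℝ) * Complex.I) =
    Complex.exp ((((1 - s) * Real.pi : ℝ) : ℂ) * Complex.I) *
      (Real.exp ((1 - s) * u - t * Real.exp u) : ℝ) := by
  rw [mlV, ml_exp_pi, Complex.ofReal_exp ((1 - s) * u - t * Real.exp u), ← Complex.exp_add]
  congr 1; push_cast; ring

lemma mlV_npi (t s u : ℝ) : mlV t s (u + (-Real.pi:ℝ) * Complex.I) =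
    Complex.exp (-(((1 - s) * Real.pi : ℝ) : ℂ) * Complex.I) *
      (Real.exp ((1 - s) * u - t * Real.exp u) : ℝ) := by
  rw [mlV, ml_exp_npi, Complex.ofReal_exp ((1 - s) * u - t * Real.exp u), ← Complex.exp_add]
  congr 1; push_cast; ring

lemma mlV_D (t s u : ℝ) : mlV t s (u + (Real.pi:ℝ) * Complex.I) -
      mlV t s (u + (-Real.pi:ℝ) * Complex.I) =
    (2 * Complex.I * (Real.sin (Real.pi * s) : ℝ)) *
      (Real.exp ((1 - s) * u - t * Real.exp u) : ℝ) := by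
  rw [mlV_pi, mlV_npi, ← sub_mul]
  congr 1
  have : Real.sin (Real.pi * s) = Real.sin ((1 - s) * Real.pi) := by
    rw [← Real.sin_pi_sub]; congr 1; ring
  rw [this, Complex.ofReal_sin, Complex.sin]
  linear_combination (Complex.exp ((((1 - s) * Real.pi : ℝ) : ℂ) * Complex.I) -
    Complex.exp (-(((1 - s) * Real.pi : ℝ) : ℂ) * Complex.I)) * Complex.I_sq

lemma mlV_hasDeriv (t s : ℝ) (w : ℂ) :
    HasDerivAt (mlV t (s + 1)) (-s * mlV t (s + 1) w + t * mlV t s w) w := by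
  have h1 : HasDerivAt (fun w : ℂ => (1 - ((s + 1 : ℝ) : ℂ)) * w + t * Complex.exp w)
      ((1 - ((s + 1 : ℝ) : ℂ)) * 1 + t * Complex.exp w) w :=
    ((hasDerivAt_id w).const_mul _).add ((Complex.hasDerivAt_exp w).const_mul _)
  have h2 := h1.cexp
  refine h2.congr_deriv ?_
  have : mlV t s w = Complex.exp w * mlV t (s + 1) w := by
    rw [mlV, mlV, ← Complex.exp_add]; congr 1; push_cast; ring
  rw [this, mlV]; push_cast; ring

lemma mlV_diff (t s : ℝ) (w : ℂ) : DifferentiableAt ℂ (mlV t s) w := by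
  unfold mlV; fun_prop

lemma mlV_norm_le {t : ℝ} (ht : 0 < t) (s u φ : ℝ) : ‖mlV t s (u + φ * Complex.I)‖ ≤
    Real.exp ((1 - s) * u + t * Real.exp u) := by
  rw [mlV, Complex.norm_exp]
  apply Real.exp_le_exp.mpr
  have h1 : (Complex.exp (u + φ * Complex.I)).re ≤ Real.exp u := by
    refine (Complex.re_le_norm _).trans ?_
    rw [Complex.norm_exp]; simp
  have h2 : ((1 - (s:ℂ)) * (u + φ * Complex.I) + t * Complex.exp (u + φ * Complex.I)).re =
      (1 - s) * u + t * (Complex.exp (u + φ * Complex.I)).re := by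
    rw [Complex.add_re, Complex.re_ofReal_mul, ← Complex.ofReal_one, ← Complex.ofReal_sub,
      Complex.re_ofReal_mul]
    simp
  rw [h2]
  nlinarith

lemma mlHk_base {t s : ℝ} (ht : 0 < t) (hs : 0 < s) (hs1 : s ≤ 1) :
    mlHk (mlV t s) = 2 * Real.pi * Complex.I * (t ^ (s - 1) / Real.Gamma s : ℝ) := by
  have hexp0 : Tendsto (fun u : ℝ => t * Real.exp u) atBot (nhds 0) := by
    simpa using Real.tendsto_exp_atBot.const_mul t
  rcases hs1.lt_or_eq with h | rfl
  · have hint := ml_gint (c := 1 - s) (by linarith) ht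
    rw [ml_shift (mlV t s) (fun w _ => mlV_diff t s w) 0
      (fun u => Real.exp ((1 - s) * u + t * Real.exp u)) ?_ ?_ ?_]
    · simp_rw [mlV_D]
      rw [integral_const_mul, integral_complex_ofReal, ml_gamma (by linarith) ht]
      have hG := Real.Gamma_mul_Gamma_one_sub s
      have hsin : 0 < Real.sin (Real.pi * s) :=
        Real.sin_pos_of_pos_of_lt_pi (by positivity) (by nlinarith [Real.pi_pos])
      have hGs := Real.Gamma_pos_of_pos hs
      have key : Real.sin (Real.pi * s) * ((1 / t) ^ (1 - s) * Real.Gamma (1 - s)) =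
          Real.pi * (t ^ (s - 1) / Real.Gamma s) := by
        have : (1 / t) ^ (1 - s) = t ^ (s - 1) := by
          rw [one_div, Real.inv_rpow ht.le, ← Real.rpow_neg ht.le]; congr 1; ring
        rw [this]
        rw [eq_div_iff hsin.ne'] at hG
        rw [← mul_div_assoc, eq_div_iff hGs.ne']
        linear_combination t ^ (s - 1) * hG
      have key' := congrArg (fun x : ℝ => (x : ℂ)) key
      push_cast at key' ⊢
      linear_combination 2 * Complex.I * key'
    · apply Real.tendsto_exp_atBot.comp
      exact (tendsto_id.const_mul_atBot (by linarith)).atBot_add hexp0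
    · exact Eventually.of_forall fun u φ => by
        rw [sub_zero]; exact mlV_norm_le ht s u φ
    · simp_rw [mlV_D]
      exact hint.ofReal.const_mul _
  · rw [ml_shift (mlV t 1) (fun w _ => mlV_diff t 1 w) 1 (fun u => 2 * (t * Real.exp u)) ?_ ?_ ?_]
    · simp_rw [mlV_D]
      simp
    · simpa using hexp0.const_mul 2
    · have : ∀ᶠ u : ℝ in atBot, t * Real.exp u < 1 := hexp0.eventually_lt_const one_pos
      filter_upwards [this] with u hu φ
      have hn : ‖(t:ℂ) * Complex.exp (u + φ * Complex.I)‖ = t * Real.exp u := by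
        rw [norm_mul, Complex.norm_exp, Complex.norm_real, Real.norm_of_nonneg ht.le]; simp
      rw [← hn, mlV]
      have := Complex.norm_exp_sub_one_le (x := (t:ℂ) * Complex.exp (u + φ * Complex.I))
        (by rw [hn]; exact hu.le)
      simpa using this
    · simp_rw [mlV_D]
      simp

lemma mlHk_rec {t : ℝ} (ht : 0 < t) (s : ℝ) :
    s * mlHk (mlV t (s + 1)) = t * mlHk (mlV t s) := by
  have hDint : ∀ r : ℝ, IntegrableOn (fun u : ℝ => mlV t r (u + (Real.pi:ℝ) * Complex.I) -
      mlV t r (u + (-Real.pi:ℝ) * Complex.I)) (Ioi 1) := by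
    intro r
    simp_rw [mlV_D]
    exact (ml_gint1 (1 - r) ht).ofReal.const_mul _
  have hcV : ∀ r u : ℝ, Continuous (fun φ : ℝ => mlV t r (u + φ * Complex.I)) := by
    intro r u; unfold mlV; fun_prop
  have hline : ∀ (y u : ℝ), HasDerivAt (fun u : ℝ => mlV t (s + 1) (u + y * Complex.I))
      (-s * mlV t (s + 1) (u + y * Complex.I) + t * mlV t s (u + y * Complex.I)) u := by
    intro y u
    have h1 : HasDerivAt (fun u : ℝ => (u:ℂ) + y * Complex.I) 1 u :=
      (Complex.ofRealCLM.hasDerivAt (x := u)).add_const _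
    have h2 := HasDerivAt.comp (h₂ := mlV t (s + 1)) u (mlV_hasDeriv t s (u + y * Complex.I)) h1
    rw [mul_one] at h2
    exact h2
  have hray := integral_Ioi_of_hasDerivAt_of_tendsto' (a := (1:ℝ)) (m := (0:ℂ))
    (fun u _ => (hline Real.pi u).sub (hline (-Real.pi) u)) (by
      refine (((hDint (s+1)).const_mul (-s:ℂ)).add ((hDint s).const_mul (t:ℂ))).congr ?_
      refine Eventually.of_forall fun u => ?_
      simp only [Pi.add_apply]
      ring) (by
      have : Tendsto (fun u : ℝ => (2 * Complex.I * (Real.sin (Real.pi * (s+1)) : ℝ)) *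
        ((Real.exp ((1 - (s+1)) * u - t * Real.exp u) : ℝ) : ℂ)) atTop (nhds 0) := by
        have h0 := (Complex.continuous_ofReal.tendsto 0).comp (ml_glim (1 - (s+1)) ht)
        simpa using h0.const_mul (2 * Complex.I * (Real.sin (Real.pi * (s+1)) : ℝ))
      refine this.congr fun u => ?_
      rw [← mlV_D]; rfl)
  have hvert : ∀ φ : ℝ, HasDerivAt (fun φ : ℝ => mlV t (s + 1) ((1:ℝ) + φ * Complex.I))
      ((-s * mlV t (s + 1) ((1:ℝ) + φ * Complex.I) + t * mlV t s ((1:ℝ) + φ * Complex.I)) *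
        Complex.I) φ := by
    intro φ
    have h1 : HasDerivAt (fun u : ℝ => ((1:ℝ):ℂ) + u * Complex.I) Complex.I φ := by
      simpa using ((Complex.ofRealCLM.hasDerivAt (x := φ)).mul_const Complex.I).const_add ((1:ℝ):ℂ)
    have h2 := HasDerivAt.comp (h₂ := mlV t (s + 1)) φ
      (mlV_hasDeriv t s ((1:ℝ) + φ * Complex.I)) h1
    exact h2
  have hmid := intervalIntegral.integral_eq_sub_of_hasDerivAt (a := -Real.pi) (b := Real.pi)
    (fun φ _ => hvert φ) (by
      refine Continuous.intervalIntegrable ?_ _ _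
      have := hcV (s+1) 1
      have := hcV s 1
      fun_prop)
  have e1 : (∫ u in Ioi (1:ℝ), (-s * mlV t (s + 1) (u + (Real.pi:ℝ) * Complex.I) +
      t * mlV t s (u + (Real.pi:ℝ) * Complex.I) -
      (-s * mlV t (s + 1) (u + (-Real.pi:ℝ) * Complex.I) +
      t * mlV t s (u + (-Real.pi:ℝ) * Complex.I)))) =
      -s * (∫ u in Ioi (1:ℝ), (mlV t (s+1) (u + (Real.pi:ℝ) * Complex.I) -
      mlV t (s+1) (u + (-Real.pi:ℝ) * Complex.I))) +
      t * (∫ u in Ioi (1:ℝ), (mlV t s (u + (Real.pi:ℝ) * Complex.I) -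
      mlV t s (u + (-Real.pi:ℝ) * Complex.I))) := by
    rw [← integral_const_mul, ← integral_const_mul, ← integral_add]
    · congr 1; ext u; ring
    · exact (hDint (s+1)).const_mul _
    · exact (hDint s).const_mul _
  have e2 : (∫ φ in (-Real.pi)..Real.pi, (-s * mlV t (s + 1) ((1:ℝ) + φ * Complex.I) +
      t * mlV t s ((1:ℝ) + φ * Complex.I)) * Complex.I) =
      (-s * (∫ φ in (-Real.pi)..Real.pi, mlV t (s + 1) ((1:ℝ) + φ * Complex.I)) +
      t * (∫ φ in (-Real.pi)..Real.pi, mlV t s ((1:ℝ) + φ * Complex.I))) * Complex.I := by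
    rw [intervalIntegral.integral_mul_const, intervalIntegral.integral_add,
      intervalIntegral.integral_const_mul, intervalIntegral.integral_const_mul]
    · exact ((hcV (s+1) 1).intervalIntegrable _ _).const_mul _
    · exact ((hcV s 1).intervalIntegrable _ _).const_mul _
  rw [e1] at hray
  rw [e2] at hmid
  simp only [Pi.sub_apply] at hray
  unfold mlHk
  linear_combination -hray - hmid

lemma mlHk_all {t : ℝ} (ht : 0 < t) (n : ℕ) : ∀ s : ℝ, 0 < s → s ≤ n + 1 →
    mlHk (mlV t s) = 2 * Real.pi * Complex.I * (t ^ (s - 1) / Real.Gamma s : ℝ) := by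
  induction n with
  | zero => intro s h1 h2; exact mlHk_base ht h1 (by simpa using h2)
  | succ n ih =>
    intro s h1 h2
    by_cases h : s ≤ 1
    · exact mlHk_base ht h1 h
    push Not at h
    have hr := mlHk_rec ht (s - 1)
    rw [ih (s - 1) (by linarith) (by push_cast at h2; linarith), sub_add_cancel] at hr
    have hG := Real.Gamma_add_one (s := s - 1) (by linarith)
    rw [sub_add_cancel] at hG
    have hne : ((s - 1 : ℝ) : ℂ) ≠ 0 := by
      norm_cast; linarith
    apply mul_left_cancel₀ hne
    rw [hr]
    have hGp := Real.Gamma_pos_of_pos (s := s - 1) (by linarith)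
    have key : t * (t ^ (s - 1 - 1) / Real.Gamma (s - 1)) =
        (s - 1) * (t ^ (s - 1) / Real.Gamma s) := by
      have : t ^ (s - 1) = t * t ^ (s - 1 - 1) := by
        rw [Real.rpow_sub_one ht.ne' (s-1)]; field_simp
      rw [hG, this]
      have : s - 1 ≠ 0 := by linarith
      field_simp
    have key' := congrArg (fun x : ℝ => (x : ℂ)) key
    push_cast at key' ⊢
    linear_combination 2 * Real.pi * Complex.I * key'

noncomputable def mlW (β t : ℝ) (w : ℂ) : ℂ :=
  Complex.exp (w + t * Complex.exp w) / (1 + Complex.exp (β * w))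

lemma mlW_ne {β : ℝ} (h0 : 0 < β) (h1 : β < 1) (w : ℂ) (hw : |w.im| ≤ Real.pi) :
    1 + Complex.exp (β * w) ≠ 0 := by
  intro h
  have hpi := Real.pi_pos
  have h2 : Complex.exp (β * w) = -1 := by linear_combination h
  have him := congrArg Complex.im h2
  have hre := congrArg Complex.re h2
  rw [Complex.exp_im] at him
  rw [Complex.exp_re] at hre
  simp only [Complex.re_ofReal_mul, Complex.im_ofReal_mul, Complex.neg_im, Complex.one_im,
    Complex.neg_re, Complex.one_re, neg_zero] at him hre
  have hs : Real.sin (β * w.im) = 0 := by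
    rcases mul_eq_zero.mp him with h | h
    · exact absurd h (Real.exp_pos _).ne'
    · exact h
  have hw' := abs_le.mp hw
  have := (Real.sin_eq_zero_iff_of_lt_of_lt (by nlinarith) (by nlinarith)).mp hs
  rw [this, Real.cos_zero] at hre
  have := Real.exp_pos (β * w.re)
  linarith

lemma mlW_diff {β : ℝ} (h0 : 0 < β) (h1 : β < 1) (t : ℝ) (w : ℂ) (hw : |w.im| ≤ Real.pi) :
    DifferentiableAt ℂ (mlW β t) w := by
  unfold mlW
  exact DifferentiableAt.div (by fun_prop) (by fun_prop) (mlW_ne h0 h1 w hw)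

lemma mlW_D {β : ℝ} (h0 : 0 < β) (h1 : β < 1) (t u : ℝ) :
    mlW β t (u + (Real.pi:ℝ) * Complex.I) - mlW β t (u + (-Real.pi:ℝ) * Complex.I) =
    2 * Real.pi * Complex.I * ((Real.exp u • (Real.exp u * Real.exp (-(Real.exp u * t)) *
      Kspec β (Real.exp u)) : ℝ) : ℂ) := by
  have hpi := Real.pi_pos
  have n1 := mlW_ne h0 h1 (u + (Real.pi:ℝ) * Complex.I) (by simp [abs_of_pos hpi])
  have n2 := mlW_ne h0 h1 (u + (-Real.pi:ℝ) * Complex.I) (by simp [abs_of_pos hpi])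
  set q : ℝ := Real.exp (β * u) with hq
  have a1 : Complex.exp (β * (u + (Real.pi:ℝ) * Complex.I)) =
      q * (Real.cos (β * Real.pi) + Real.sin (β * Real.pi) * Complex.I) := by
    rw [hq, Complex.ofReal_exp, Complex.ofReal_cos, Complex.ofReal_sin, ← Complex.exp_mul_I,
      ← Complex.exp_add]
    congr 1; push_cast; ring
  have a2 : Complex.exp (β * (u + (-Real.pi:ℝ) * Complex.I)) =
      q * (Real.cos (β * Real.pi) - Real.sin (β * Real.pi) * Complex.I) := by
    have : (Real.cos (β * Real.pi) - Real.sin (β * Real.pi) * Complex.I : ℂ) =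
      Complex.cos (-(β * Real.pi : ℝ) : ℂ) + Complex.sin (-(β * Real.pi : ℝ) : ℂ) * Complex.I := by
      rw [Complex.cos_neg, Complex.sin_neg, Complex.ofReal_cos, Complex.ofReal_sin]; ring
    rw [this, hq, Complex.ofReal_exp, ← Complex.exp_mul_I,
      ← Complex.exp_add]
    congr 1; push_cast; ring
  rw [a1] at n1
  rw [a2] at n2
  have hcs : ((Real.cos (β * Real.pi) : ℝ) : ℂ) ^ 2 + ((Real.sin (β * Real.pi) : ℝ) : ℂ) ^ 2 = 1 := by
    norm_cast; exact Real.cos_sq_add_sin_sq _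
  have hprod : ((q ^ 2 + 2 * q * Real.cos (β * Real.pi) + 1 : ℝ) : ℂ) =
      (1 + q * (Real.cos (β * Real.pi) + Real.sin (β * Real.pi) * Complex.I)) *
      (1 + q * (Real.cos (β * Real.pi) - Real.sin (β * Real.pi) * Complex.I)) := by
    push_cast at hcs ⊢
    linear_combination (-(q:ℂ)^2) * hcs + (q:ℂ)^2 * Complex.sin (β * Real.pi) ^ 2 * Complex.I_sq
  have hK : Real.exp u • (Real.exp u * Real.exp (-(Real.exp u * t)) *
      Kspec β (Real.exp u)) = Real.exp u * Real.exp (-(Real.exp u * t)) * ((1 / Real.pi) *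
      (q * Real.sin (β * Real.pi)) / (q ^ 2 + 2 * q * Real.cos (β * Real.pi) + 1)) := by
    have b1 : Real.exp u ^ (β - 1) = q / Real.exp u := by
      rw [Real.rpow_sub_one (Real.exp_pos u).ne', ← Real.exp_mul, hq, mul_comm u]
    have b2 : Real.exp u ^ (2 * β) = q ^ 2 := by
      rw [← Real.exp_mul, hq, sq, ← Real.exp_add]; congr 1; ring
    have b3 : Real.exp u ^ β = q := by rw [← Real.exp_mul, hq, mul_comm u]
    rw [Kspec, b1, b2, b3, smul_eq_mul]
    have := (Real.exp_pos u).ne'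
    field_simp
  rw [hK]
  have c1 : Complex.exp (u + (Real.pi:ℝ) * Complex.I + t * Complex.exp (u + (Real.pi:ℝ) * Complex.I))
      = -(Real.exp u * Real.exp (-(Real.exp u * t)) : ℝ) := by
    rw [Complex.exp_add, ml_exp_pi]; push_cast; rw [neg_mul]; congr 3; ring
  have c2 : Complex.exp (u + (-Real.pi:ℝ) * Complex.I +
      t * Complex.exp (u + (-Real.pi:ℝ) * Complex.I))
      = -(Real.exp u * Real.exp (-(Real.exp u * t)) : ℝ) := by
    rw [Complex.exp_add, ml_exp_npi]; push_cast; rw [neg_mul]; congr 3; ring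
  rw [mlW, mlW, a1, a2, c1, c2, div_sub_div _ _ n1 n2, ← hprod]
  have hne : ((q ^ 2 + 2 * q * Real.cos (β * Real.pi) + 1 : ℝ) : ℂ) ≠ 0 := by
    rw [hprod]; exact mul_ne_zero n1 n2
  rw [Complex.ofReal_mul _ (_ / _), Complex.ofReal_div _ (q ^ 2 + 2 * q * Real.cos (β * Real.pi) + 1)]
  rw [div_eq_iff hne, mul_assoc, mul_assoc, mul_assoc, mul_assoc, div_mul_cancel₀ _ hne]
  have hpc : (Real.pi : ℂ) ≠ 0 := by exact_mod_cast hpi.ne'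
  push_cast
  field_simp
  ring

/-- The functional value of `mlW` equals the spectral integral. -/
lemma mlHk_W {β t : ℝ} (h0 : 0 < β) (h1 : β < 1) (ht : 0 < t) :
    mlHk (mlW β t) = 2 * Real.pi * Complex.I *
      ((∫ θ in Ioi (0:ℝ), θ * Real.exp (-(θ * t)) * Kspec β θ : ℝ) : ℂ) := by
  have hpi := Real.pi_pos
  have hsin : 0 < Real.sin (β * Real.pi) :=
    Real.sin_pos_of_pos_of_lt_pi (by positivity) (by nlinarith)
  have hcs := Real.cos_sq_add_sin_sq (β * Real.pi)
  have hint : Integrable (fun u : ℝ => Real.exp u • (Real.exp u * Real.exp (-(Real.exp u * t)) *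
      Kspec β (Real.exp u))) := by
    rw [← ml_chg_int (fun θ => θ * Real.exp (-(θ * t)) * Kspec β θ)]
    have hb := (integrableOn_exp_mul_Ioi (a := -t) (by linarith) 0)
    have hb := hb.const_mul (1 / (Real.pi * Real.sin (β * Real.pi)))
    refine Integrable.mono' hb ?_ ?_
    · apply Measurable.aestronglyMeasurable
      unfold Kspec
      fun_prop
    · refine (ae_restrict_iff' measurableSet_Ioi).mpr (ae_of_all _ fun θ hθ => ?_)
      have hθ : 0 < θ := hθ
      have e1 : θ ^ (2 * β) = (θ ^ β) ^ 2 := by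
        rw [mul_comm, Real.rpow_mul hθ.le]; simp
      have e2 : θ ^ (β - 1) = θ ^ β / θ := Real.rpow_sub_one hθ.ne' _
      have hq : 0 < θ ^ β := Real.rpow_pos_of_pos hθ _
      have eE : Real.exp (-(θ * t)) = Real.exp (-t * θ) := by congr 1; ring
      rw [Kspec, e1, e2, eE]
      set q := θ ^ β
      set S := Real.sin (β * Real.pi)
      set C := Real.cos (β * Real.pi)
      have hden : q ^ 2 * S ^ 2 + (q * C + 1) ^ 2 = q ^ 2 + 2 * q * C + 1 := by
        linear_combination q ^ 2 * hcs
      have hden2 : S ^ 2 + (q + C) ^ 2 = q ^ 2 + 2 * q * C + 1 := by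
        linear_combination hcs
      have hdpos : 0 < q ^ 2 + 2 * q * C + 1 := by rw [← hden2]; positivity
      have hqS : q * S ^ 2 ≤ q ^ 2 + 2 * q * C + 1 := by
        by_cases hq1 : q ≤ 1
        · nlinarith [sq_nonneg (q + C), sq_nonneg S]
        · push Not at hq1
          nlinarith [sq_nonneg (q * C + 1), sq_nonneg S, mul_pos hq hq]
      have e3 : θ * Real.exp (-t * θ) * (1 / Real.pi * (q / θ * S) / (q ^ 2 + 2 * q * C + 1)) =
          (q * S / (q ^ 2 + 2 * q * C + 1) / Real.pi) * Real.exp (-t * θ) := by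
        field_simp
      rw [e3, Real.norm_of_nonneg (by positivity)]
      refine mul_le_mul_of_nonneg_right ?_ (Real.exp_pos _).le
      rw [div_div, div_le_div_iff₀ (by positivity) (by positivity)]
      nlinarith [mul_le_mul_of_nonneg_left hqS hpi.le]
  rw [ml_shift (mlW β t) (fun w hw => mlW_diff h0 h1 t w hw) 0
    (fun u => Real.exp (u + t * Real.exp u) / (1 - Real.exp (β * u))) ?_ ?_ ?_]
  · simp_rw [mlW_D h0 h1]
    rw [integral_const_mul, integral_complex_ofReal,
      ml_chg (fun θ => θ * Real.exp (-(θ * t)) * Kspec β θ)]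
    ring
  · have hexp0 : Tendsto (fun u : ℝ => t * Real.exp u) atBot (nhds 0) := by
      simpa using Real.tendsto_exp_atBot.const_mul t
    have l1 : Tendsto (fun u : ℝ => Real.exp (u + t * Real.exp u)) atBot (nhds 0) :=
      Real.tendsto_exp_atBot.comp (tendsto_id.atBot_add hexp0)
    have l2 : Tendsto (fun u : ℝ => 1 - Real.exp (β * u)) atBot (nhds (1 - 0)) :=
      (Real.tendsto_exp_atBot.comp (tendsto_id.const_mul_atBot h0)).const_sub 1
    have l3 := l1.div l2 (by norm_num)
    rw [zero_div] at l3
    exact l3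
  · filter_upwards [eventually_lt_atBot (0:ℝ)] with u hu φ
    have hV := mlV_norm_le ht 0 u φ
    have hVe : mlV t 0 (u + φ * Complex.I) =
      Complex.exp (u + φ * Complex.I + t * Complex.exp (u + φ * Complex.I)) := by
      simp [mlV]
    rw [hVe] at hV
    have hn : ‖Complex.exp (β * (u + φ * Complex.I))‖ = Real.exp (β * u) := by
      rw [Complex.norm_exp, Complex.re_ofReal_mul]; simp
    have hd : 1 - Real.exp (β * u) ≤ ‖1 + Complex.exp (β * (u + φ * Complex.I))‖ := by
      have := norm_sub_le_norm_add (1:ℂ) (Complex.exp (β * (u + φ * Complex.I)))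
      rw [hn, norm_one] at this
      exact this
    have hlt : Real.exp (β * u) < 1 := by
      rw [Real.exp_lt_one_iff]; nlinarith
    rw [sub_zero, mlW, norm_div]
    simp only [sub_zero, one_mul] at hV
    exact div_le_div₀ (Real.exp_pos _).le hV (by linarith) hd
  · simp_rw [mlW_D h0 h1]
    exact hint.ofReal.const_mul _

lemma mlW_hasSum {β : ℝ} (h0 : 0 < β) (t : ℝ) (w : ℂ) (hw : 0 < w.re) :
    HasSum (fun n : ℕ => (-1) ^ n * mlV t (β * (n + 1)) w) (mlW β t w) := by
  have hq0 : Complex.exp (β * w) ≠ 0 := Complex.exp_ne_zero _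
  have hn : ‖-(Complex.exp (β * w))⁻¹‖ < 1 := by
    rw [norm_neg, norm_inv, Complex.norm_exp, Complex.re_ofReal_mul, ← Real.exp_neg,
      Real.exp_lt_one_iff]
    nlinarith
  have h := (hasSum_geometric_of_norm_lt_one hn).mul_left
    (Complex.exp (w + t * Complex.exp w) * (Complex.exp (β * w))⁻¹)
  have hne : 1 - -(Complex.exp (β * w))⁻¹ ≠ 0 := by
    intro h
    have : -(Complex.exp (β * w))⁻¹ = 1 := by linear_combination -h
    rw [this, norm_one] at hn
    exact lt_irrefl _ hn
  convert h using 1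
  · rfl
  · funext n
    have : mlV t (β * (n + 1)) w =
        Complex.exp (w + t * Complex.exp w) * (Complex.exp (β * w))⁻¹ ^ (n + 1) := by
      rw [← Complex.exp_neg, ← Complex.exp_nat_mul, ← Complex.exp_add, mlV]
      congr 1; push_cast; ring
    rw [this, neg_pow (Complex.exp (β * w))⁻¹]
    ring
  · rw [mlW]
    have : 1 - -(Complex.exp (β * w))⁻¹ = (1 + Complex.exp (β * w)) * (Complex.exp (β * w))⁻¹ := by
      field_simp; ring
    rw [this, mul_inv, inv_inv]
    field_simp

lemma mlHk_hasSum {β t : ℝ} (h0 : 0 < β) (ht : 0 < t) :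
    HasSum (fun n : ℕ => (-1) ^ n * mlHk (mlV t (β * (n + 1)))) (mlHk (mlW β t)) := by
  have hr : Summable (fun n : ℕ => Real.exp (-β) ^ n) :=
    summable_geometric_of_lt_one (Real.exp_pos _).le (by rw [Real.exp_lt_one_iff]; linarith)
  have hpow : ∀ n : ℕ, Real.exp (-β) ^ n = Real.exp (-(β * n)) := by
    intro n; rw [← Real.exp_nat_mul]; congr 1; ring
  have hmid : HasSum (fun n : ℕ => ∫ φ in (-Real.pi)..Real.pi,
      (-1) ^ n * mlV t (β * (n + 1)) ((1:ℝ) + φ * Complex.I))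
      (∫ φ in (-Real.pi)..Real.pi, mlW β t ((1:ℝ) + φ * Complex.I)) := by
    apply intervalIntegral.hasSum_integral_of_dominated_convergence
      (fun n _ => Real.exp (-β) ^ n * Real.exp (1 - β + t * Real.exp 1))
    · intro n
      apply Continuous.aestronglyMeasurable
      unfold mlV; fun_prop
    · intro n
      refine ae_of_all _ fun φ _ => ?_
      rw [norm_mul, norm_pow, norm_neg, norm_one, one_pow, one_mul]
      refine (mlV_norm_le ht _ 1 φ).trans (le_of_eq ?_)
      rw [hpow, ← Real.exp_add]; congr 1; ring
    · exact ae_of_all _ fun φ _ => hr.mul_right _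
    · simp
    · refine ae_of_all _ fun φ _ => mlW_hasSum h0 t _ (by simp)
  have hray : HasSum (fun n : ℕ => ∫ u in Ioi (1:ℝ),
      (-1) ^ n * (mlV t (β * (n + 1)) (u + (Real.pi:ℝ) * Complex.I) -
        mlV t (β * (n + 1)) (u + (-Real.pi:ℝ) * Complex.I)))
      (∫ u in Ioi (1:ℝ), (mlW β t (u + (Real.pi:ℝ) * Complex.I) -
        mlW β t (u + (-Real.pi:ℝ) * Complex.I))) := by
    apply hasSum_integral_of_dominated_convergence
      (fun n u => Real.exp (-β) ^ n * (2 * Real.exp ((1 - β) * u - t * Real.exp u)))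
    · intro n
      apply Continuous.aestronglyMeasurable
      unfold mlV; fun_prop
    · intro n
      refine (ae_restrict_iff' measurableSet_Ioi).mpr (ae_of_all _ fun u hu => ?_)
      have hu : (1:ℝ) < u := hu
      rw [norm_mul, norm_pow, norm_neg, norm_one, one_pow, one_mul, mlV_D, norm_mul, norm_mul,
        norm_mul, Complex.norm_I, Complex.norm_real, Complex.norm_real, Real.norm_eq_abs,
        Real.norm_eq_abs, Real.abs_exp, Complex.norm_ofNat, mul_one]
      have hs := Real.abs_sin_le_one (Real.pi * (β * (n + 1)))
      have he : Real.exp ((1 - β * (n + 1)) * u - t * Real.exp u) ≤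
          Real.exp (-β) ^ n * Real.exp ((1 - β) * u - t * Real.exp u) := by
        rw [hpow, ← Real.exp_add]
        apply Real.exp_le_exp.mpr
        have : 0 ≤ β * n := by positivity
        nlinarith
      calc 2 * |Real.sin (Real.pi * (β * (n + 1)))| *
            Real.exp ((1 - β * (n + 1)) * u - t * Real.exp u)
          ≤ 2 * 1 * (Real.exp (-β) ^ n * Real.exp ((1 - β) * u - t * Real.exp u)) := by gcongr
        _ = _ := by ring
    · exact ae_of_all _ fun u => hr.mul_right _
    · simp_rw [tsum_mul_right]
      exact ((ml_gint1 (1 - β) ht).const_mul 2).const_mul _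
    · refine (ae_restrict_iff' measurableSet_Ioi).mpr (ae_of_all _ fun u hu => ?_)
      have hu : (1:ℝ) < u := hu
      have s1 := mlW_hasSum h0 t (u + (Real.pi:ℝ) * Complex.I) (by simp; linarith)
      have s2 := mlW_hasSum h0 t (u + (-Real.pi:ℝ) * Complex.I) (by simp; linarith)
      simpa only [mul_sub] using s1.sub s2
  have := (hmid.mul_left Complex.I).add hray
  refine (this.congr_fun ?_)
  intro n
  rw [intervalIntegral.integral_const_mul, integral_const_mul, mlHk]
  ring

/-- Spectral representation of the Mittag-Leffler density:
`f_β(t) = ∫_0^∞ θ e^{-θt} K_β(θ) dθ` for `β ∈ (0,1)`, `t > 0`. -/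
theorem mittagLeffler_density_spectral_rep (β : ℝ) (hβ : β ∈ Set.Ioo (0:ℝ) 1)
    (t : ℝ) (ht : 0 < t) :
    fML β t = ∫ θ in Set.Ioi (0:ℝ), θ * Real.exp (-(θ * t)) * Kspec β θ := by
  obtain ⟨h0, h1⟩ := hβ
  have h := mlHk_hasSum h0 ht
  rw [mlHk_W h0 h1 ht] at h
  have hc : (2 * Real.pi * Complex.I : ℂ) ≠ 0 := by
    simp [Real.pi_pos.ne']
  have h2 : HasSum (fun n : ℕ => (2 * Real.pi * Complex.I : ℂ) *
      ((t ^ (β - 1) * ((-(t ^ β)) ^ n / Real.Gamma (n * β + β)) : ℝ) : ℂ))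
      (2 * Real.pi * Complex.I *
      ((∫ θ in Ioi (0:ℝ), θ * Real.exp (-(θ * t)) * Kspec β θ : ℝ) : ℂ)) := by
    refine h.congr_fun fun n => ?_
    obtain ⟨N, hN⟩ := exists_nat_ge (β * (n + 1))
    rw [mlHk_all ht N (β * (n + 1)) (by positivity) (by linarith)]
    have e1 : t ^ (β * (n + 1) - 1) = t ^ (β - 1) * (t ^ β) ^ n := by
      rw [← Real.rpow_natCast, ← Real.rpow_mul ht.le, ← Real.rpow_add ht]
      congr 1; ring
    have e2 : (n:ℝ) * β + β = β * (n + 1) := by ring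
    rw [e1, e2, neg_pow]
    push_cast
    ring
  have h3 := (hasSum_mul_left_iff hc).mp h2
  have h4 := (Complex.hasSum_ofReal).mp h3
  rw [fML, ML2, ← tsum_mul_left]
  exact h4.tsum_eq
end

section
/- Let β ∈ (0,1]. The function f_β(t) = t^{β-1} E_{β,β}(-t^β) is a probability density on (0,∞): f_β(t) ≥ 0 for all t > 0 and ∫_0^∞ f_β(t) dt = 1. -/
open MeasureTheory Set Filter

lemma aux_gamma_lower {M y : ℝ} (hM : 0 < M) (hy : 1 ≤ y) :
    Real.exp (-(M+1)) * M ^ (y-1) ≤ Real.Gamma y := by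
  have hy0 : 0 < y := by linarith
  rw [Real.Gamma_eq_integral hy0]
  have hint := Real.GammaIntegral_convergent hy0
  have h1 : ∫ x in Ioc M (M+1), Real.exp (-x) * x ^ (y-1) ≤
      ∫ x in Ioi (0:ℝ), Real.exp (-x) * x ^ (y-1) := by
    apply setIntegral_mono_set hint
    · filter_upwards [self_mem_ae_restrict measurableSet_Ioi] with x hx
      have : (0:ℝ) < x := hx
      simp only [Pi.zero_apply]
      positivity
    · have hs : Ioc M (M+1) ⊆ Ioi 0 := fun x hx => lt_trans hM hx.1
      exact ae_of_all _ hs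
  refine le_trans ?_ h1
  have h2 : ∫ x in Ioc M (M+1), Real.exp (-(M+1)) * M ^ (y-1) ≤
      ∫ x in Ioc M (M+1), Real.exp (-x) * x ^ (y-1) := by
    apply setIntegral_mono_on
    · exact integrableOn_const (by simp)
    · exact hint.mono_set (fun x hx => lt_trans hM hx.1)
    · exact measurableSet_Ioc
    · intro x hx
      have := hx.1
      have := hx.2
      gcongr
  simpa using h2

lemma aux_summable {β δ x : ℝ} (hβ : 0 < β) (hx : 0 ≤ x) :
    Summable (fun n : ℕ => x ^ n / Real.Gamma (n * β + δ)) := by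
  set M : ℝ := (2 * x + 1) ^ (1/β) with hM
  have hM0 : 0 < M := by positivity
  have hMb : M ^ β = 2 * x + 1 := by
    rw [hM, ← Real.rpow_mul (by positivity), one_div_mul_cancel hβ.ne', Real.rpow_one]
  have hgeo : Summable (fun n : ℕ => (Real.exp (M+1) * M ^ (1-δ)) * (x / (2*x+1)) ^ n) := by
    apply Summable.mul_left
    apply summable_geometric_of_lt_one (by positivity)
    rw [div_lt_one (by positivity)]; linarith
  apply Summable.of_norm_bounded_eventually_nat hgeo
  have : Tendsto (fun n : ℕ => (n:ℝ) * β + δ) atTop atTop :=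
    tendsto_atTop_add_const_right _ _ (tendsto_natCast_atTop_atTop.atTop_mul_const hβ)
  filter_upwards [this.eventually_ge_atTop 1] with n hn
  have hG := aux_gamma_lower hM0 hn
  have hGp : 0 < Real.Gamma (n * β + δ) := Real.Gamma_pos_of_pos (by linarith)
  rw [Real.norm_of_nonneg (by positivity), div_le_iff₀ hGp]
  have e : M ^ (n * β + δ - 1) = (2*x+1)^n * M ^ (δ-1) := by
    rw [← hMb, ← Real.rpow_natCast, ← Real.rpow_mul hM0.le, ← Real.rpow_add hM0]
    congr 1; ring
  calc x ^ n = (Real.exp (M+1) * M ^ (1-δ)) * (x / (2*x+1)) ^ n *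
        (Real.exp (-(M+1)) * M ^ (n * β + δ - 1)) := by
        rw [e, div_pow, Real.exp_neg]
        have h3 : M ^ (1-δ) * M ^ (δ-1) = 1 := by
          rw [← Real.rpow_add hM0]; simp
        have h4 : (2*x+1)^n ≠ 0 := by positivity
        have h5 := (Real.exp_pos (M+1)).ne'
        field_simp
        linear_combination (-1) * x^n * h3
    _ ≤ _ := by gcongr

lemma aux_beta {a b t : ℝ} (ha : 0 < a) (hb : 0 < b) (ht : 0 < t) :
    ∫ s in Ioo 0 t, s ^ (b-1) * (t-s) ^ (a-1) =
      t ^ (b+a-1) * (Real.Gamma b * Real.Gamma a / Real.Gamma (b+a)) := by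
  have h := Complex.betaIntegral_scaled b a ht
  rw [Complex.betaIntegral_eq_Gamma_mul_div _ _ (by simpa) (by simpa)] at h
  rw [intervalIntegral.integral_of_le ht.le, integral_Ioc_eq_integral_Ioo] at h
  have : ∫ s in Ioo 0 t, (s:ℂ) ^ ((b:ℂ)-1) * ((t:ℂ)-s) ^ ((a:ℂ)-1) =
      ∫ s in Ioo 0 t, ((s ^ (b-1) * (t-s) ^ (a-1) : ℝ) : ℂ) := by
    apply setIntegral_congr_fun measurableSet_Ioo
    intro s hs
    simp only
    push_cast
    rw [Complex.ofReal_cpow hs.1.le, Complex.ofReal_cpow (by linarith [hs.2])]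
    push_cast; rfl
  rw [this, integral_complex_ofReal] at h
  rw [← Complex.ofReal_inj, h, Complex.ofReal_mul, Complex.ofReal_cpow ht.le]
  push_cast
  simp only [← Complex.ofReal_add, Complex.Gamma_ofReal]

lemma aux_beta_int {a b t : ℝ} (ha : 0 < a) (hb : 0 < b) (ht : 0 < t) :
    IntegrableOn (fun s => s ^ (b-1) * (t-s) ^ (a-1)) (Ioo 0 t) := by
  by_contra hc
  have h := aux_beta ha hb ht
  rw [integral_undef hc] at h
  have := Real.Gamma_pos_of_pos ha
  have := Real.Gamma_pos_of_pos hb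
  have := Real.Gamma_pos_of_pos (add_pos hb ha)
  have : 0 < t ^ (b+a-1) * (Real.Gamma b * Real.Gamma a / Real.Gamma (b+a)) := by positivity
  linarith

lemma aux_Gpos {β : ℝ} (hβ : 0 < β) (n : ℕ) : 0 < Real.Gamma (n * β + β) :=
  Real.Gamma_pos_of_pos (by positivity)

lemma aux_hasSum {β : ℝ} (hβ : 0 < β) (z : ℝ) :
    HasSum (fun n : ℕ => z ^ n / Real.Gamma (n * β + β)) (ML2 β β z) := by
  apply Summable.hasSum
  apply Summable.of_norm
  have := aux_summable (δ := β) hβ (abs_nonneg z)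
  refine this.congr (fun n => ?_)
  rw [norm_div, norm_pow, Real.norm_eq_abs, Real.norm_of_nonneg (aux_Gpos hβ n).le]

lemma aux_cont {β : ℝ} (hβ : 0 < β) : Continuous (ML2 β β) := by
  rw [continuous_iff_continuousAt]
  intro z
  have : ContinuousOn (ML2 β β) (Metric.ball 0 (|z|+1)) := by
    unfold ML2
    apply continuousOn_tsum (u := fun n : ℕ => (|z|+1) ^ n / Real.Gamma (n * β + β))
    · intro n; fun_prop
    · exact aux_summable hβ (by positivity)
    · intro n x hx
      rw [norm_div, norm_pow, Real.norm_of_nonneg (aux_Gpos hβ n).le]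
      have := aux_Gpos hβ n
      have : ‖x‖ ≤ |z|+1 := by simpa using (Metric.mem_ball.1 hx).le
      gcongr
  exact this.continuousAt (Metric.isOpen_ball.mem_nhds (by simp))

lemma aux_fcont {β : ℝ} (hβ : 0 < β) : ContinuousOn (fML β) (Ioi 0) := by
  unfold fML
  apply ContinuousOn.mul
  · exact continuousOn_id.rpow_const (fun x hx => Or.inl (ne_of_gt hx))
  · refine (aux_cont hβ).comp_continuousOn (ContinuousOn.neg ?_)
    exact continuousOn_id.rpow_const (fun x hx => Or.inl (ne_of_gt hx))

lemma aux_conv {β a t : ℝ} (hβ : 0 < β) (ha : 0 < a) (ht : 0 < t) :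
    IntegrableOn (fun s => (t-s) ^ (a-1) * fML β s) (Ioo 0 t) ∧
    HasSum (fun n : ℕ => (-1) ^ n * t ^ (n * β + β + a - 1) *
        (Real.Gamma a / Real.Gamma (n * β + β + a)))
      (∫ s in Ioo 0 t, (t-s) ^ (a-1) * fML β s) := by
  have hb := aux_beta_int ha hβ ht
  have hm : MeasurableSet (Ioo 0 t) := measurableSet_Ioo
  have hsum := aux_hasSum hβ (t^β)
  have hterm : ∀ n : ℕ, ∀ s ∈ Ioo 0 t, ‖(-(s^β))^n / Real.Gamma (n*β+β)‖ ≤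
      (t^β)^n / Real.Gamma (n*β+β) := by
    intro n s hs
    have := aux_Gpos hβ n
    have h0 := hs.1
    have h1 := hs.2
    rw [norm_div, norm_pow, Real.norm_of_nonneg this.le, norm_neg,
      Real.norm_of_nonneg (by positivity)]
    gcongr
  constructor
  · have hb2 := hb.mul_const (ML2 β β (t^β))
    refine Integrable.mono' hb2 ?_ ?_
    · apply ContinuousOn.aestronglyMeasurable _ hm
      apply ContinuousOn.mul
      · refine ContinuousOn.rpow_const (by fun_prop) (fun x hx => Or.inl ?_)
        linarith [hx.2]
      · exact (aux_fcont hβ).mono (fun x hx => hx.1)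
    · filter_upwards [self_mem_ae_restrict hm] with s hs
      have h0 := hs.1
      have h1 : 0 < t - s := by linarith [hs.2]
      have h2 : ‖ML2 β β (-(s^β))‖ ≤ ML2 β β (t^β) :=
        (tsum_of_norm_bounded hsum (fun n => hterm n s hs))
      rw [fML, norm_mul, norm_mul, Real.norm_of_nonneg (by positivity),
        Real.norm_of_nonneg (by positivity)]
      calc _ = s ^ (β-1) * (t-s) ^ (a-1) * ‖ML2 β β (-(s^β))‖ := by ring
        _ ≤ _ := by gcongr
  · have key := hasSum_integral_of_dominated_convergence (μ := volume.restrict (Ioo 0 t))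
      (F := fun (n:ℕ) s => (t-s) ^ (a-1) * (s^(β-1) * ((-(s^β))^n / Real.Gamma (n*β+β))))
      (f := fun s => (t-s) ^ (a-1) * fML β s)
      (fun n s => s ^ (β-1) * (t-s) ^ (a-1) * ((t^β)^n / Real.Gamma (n*β+β)))
      ?_ ?_ ?_ ?_ ?_
    · refine Eq.mp (congrArg (fun g : ℕ → ℝ => HasSum g _) (funext fun n => ?_)) key
      symm
      have e : ∀ s ∈ Ioo 0 t, (t-s) ^ (a-1) * (s^(β-1) * ((-(s^β))^n / Real.Gamma (n*β+β))) =
          ((-1)^n / Real.Gamma (n*β+β)) * (s^(n*β+β-1) * (t-s)^(a-1)) := by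
        intro s hs
        have : s^(n*β+β-1) = (s^β)^n * s^(β-1) := by
          rw [← Real.rpow_natCast, ← Real.rpow_mul hs.1.le, ← Real.rpow_add hs.1]
          congr 1; ring
        rw [this, neg_pow]; ring
      rw [setIntegral_congr_fun hm e, integral_const_mul, aux_beta ha (by positivity) ht]
      have := aux_Gpos hβ n
      field_simp
    · intro n
      have : Measurable (fun s => (t-s) ^ (a-1) * (s^(β-1) * ((-(s^β))^n / Real.Gamma (n*β+β)))) := by
        fun_prop
      exact this.aestronglyMeasurable
    · intro n
      filter_upwards [self_mem_ae_restrict hm] with s hs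
      have h0 := hs.1
      have h1 : 0 < t - s := by linarith [hs.2]
      rw [norm_mul, norm_mul, Real.norm_of_nonneg (by positivity : 0 ≤ (t-s)^(a-1)),
        Real.norm_of_nonneg (by positivity : 0 ≤ s^(β-1))]
      have := hterm n s hs
      calc _ = s ^ (β-1) * (t-s) ^ (a-1) * ‖(-(s^β))^n / Real.Gamma (n*β+β)‖ := by ring
        _ ≤ _ := by gcongr
    · exact ae_of_all _ (fun s => hsum.summable.mul_left _)
    · simp_rw [tsum_mul_left]
      exact hb.mul_const _
    · exact ae_of_all _ (fun s => ((aux_hasSum hβ _).mul_left _).mul_left _)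

lemma aux_shift {φ χ : ℕ → ℝ} {c S J : ℝ} (hφ : HasSum φ S) (hχ : HasSum χ J)
    (h : ∀ n, χ n = -c * φ (n+1)) : J = c * (φ 0 - S) := by
  have h1 : HasSum (fun n => φ (n+1)) (S - φ 0) := by
    simpa using (hasSum_nat_add_iff' 1).2 hφ
  have h2 := h1.mul_left (-c)
  have h3 : χ = fun n => -c * φ (n+1) := funext h
  rw [h3] at hχ
  rw [hχ.unique h2]; ring

lemma aux_volt {β t : ℝ} (hβ : 0 < β) (ht : 0 < t) :
    ∫ s in Ioo 0 t, (t-s) ^ (β-1) * fML β s = t ^ (β-1) - Real.Gamma β * fML β t := by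
  have h1 : HasSum (fun n : ℕ => t ^ (β-1) * ((-(t^β))^n / Real.Gamma (n*β+β))) (fML β t) :=
    (aux_hasSum hβ (-(t^β))).mul_left _
  have hG := Real.Gamma_pos_of_pos hβ
  rw [aux_shift (c := Real.Gamma β) h1 (aux_conv hβ hβ ht).2]
  · simp; field_simp
  · intro n
    have e : t ^ (n*β+β+β-1) = t^(β-1) * (t^β)^(n+1) := by
      rw [← Real.rpow_natCast, ← Real.rpow_mul ht.le, ← Real.rpow_add ht]
      congr 1; push_cast; ring
    rw [e, neg_pow (t^β)]
    have e2 : ((n+1:ℕ):ℝ)*β+β = n*β+β+β := by push_cast; ring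
    rw [e2]; ring

lemma aux_volt2 {β t : ℝ} (hβ : 0 < β) (ht : 0 < t) :
    ∫ s in Ioo 0 t, (t-s) ^ β * fML β s =
      t ^ β - Real.Gamma (β+1) * ∫ s in Ioo 0 t, fML β s := by
  have h1 := (aux_conv hβ one_pos ht).2
  have h2 := (aux_conv hβ (a := β+1) (by positivity) ht).2
  simp only [sub_self, Real.rpow_zero, one_mul, add_sub_cancel_right] at h1 h2
  have hG := Real.Gamma_pos_of_pos (add_pos hβ one_pos)
  rw [aux_shift (c := Real.Gamma (β+1)) h1 h2]
  · simp; field_simp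
  · intro n
    have e2 : ((n+1:ℕ):ℝ)*β+β+1 = n*β+β+(β+1) := by push_cast; ring
    have e3 : ((n+1:ℕ):ℝ)*β+β = n*β+β+(β+1) - 1 := by push_cast; ring
    rw [e2, e3, Real.Gamma_one]; ring

lemma aux_near {β : ℝ} (hβ : 0 < β) : ∃ ε > 0, ∀ t ∈ Ioo 0 ε, 0 < fML β t := by
  have h0 : ML2 β β 0 = 1 / Real.Gamma β := by
    rw [ML2, tsum_eq_single 0]
    · simp
    · intro n hn; simp [hn]
  have hc : ContinuousAt (fun t : ℝ => ML2 β β (-(t^β))) 0 := by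
    apply (aux_cont hβ).continuousAt.comp
    exact (Real.continuousAt_rpow_const 0 β (Or.inr hβ.le)).neg
  have hG := Real.Gamma_pos_of_pos hβ
  have hpos : 0 < ML2 β β (-((0:ℝ)^β)) := by
    rw [Real.zero_rpow hβ.ne', neg_zero, h0]; positivity
  obtain ⟨ε, hε, h⟩ := Metric.eventually_nhds_iff.1 (hc.eventually (lt_mem_nhds hpos))
  refine ⟨ε, hε, fun t ht => ?_⟩
  have := h (y := t) (by rw [Real.dist_eq, sub_zero, abs_of_pos ht.1]; exact ht.2)
  have := ht.1
  unfold fML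
  positivity

lemma aux_rint {β t T : ℝ} (hβ : 0 < β) (h : t < T) :
    ∫ s in Ioo t T, (T-s)^(β-1) = (T-t)^β/β := by
  rw [← integral_Ioc_eq_integral_Ioo, ← intervalIntegral.integral_of_le h.le,
    intervalIntegral.integral_comp_sub_left (fun x => x^(β-1)) T, integral_rpow (Or.inl (by linarith))]
  simp [Real.zero_rpow hβ.ne']

lemma aux_rint' {β t T : ℝ} (hβ : 0 < β) (h : t < T) :
    IntegrableOn (fun s => (T-s)^(β-1)) (Ioo t T) := by
  by_contra hc
  have h1 := aux_rint hβ h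
  rw [integral_undef hc] at h1
  have : 0 < T - t := by linarith
  have : 0 < (T-t)^β/β := by positivity
  linarith

lemma aux_pos {β : ℝ} (hβ : 0 < β) (hβ1 : β ≤ 1) {x : ℝ} (hx : 0 < x) : 0 < fML β x := by
  by_contra hneg
  push Not at hneg
  obtain ⟨ε, hε, hnear⟩ := aux_near hβ
  set S : Set ℝ := Ici ε ∩ fML β ⁻¹' (Iic 0) with hS
  have hSc : IsClosed S :=
    ((aux_fcont hβ).mono (fun y hy => lt_of_lt_of_le hε hy)).preimage_isClosed_of_isClosed
      isClosed_Ici isClosed_Iic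
  have hxS : x ∈ S := by
    refine ⟨?_, hneg⟩
    by_contra hc
    exact absurd (hnear x ⟨hx, not_le.1 hc⟩) (not_lt.2 hneg)
  have hbdd : BddBelow S := ⟨ε, fun y hy => hy.1⟩
  have hTS := hSc.csInf_mem ⟨x, hxS⟩ hbdd
  set T := sInf S with hT
  have hT0 : 0 < T := lt_of_lt_of_le hε hTS.1
  have hfT : fML β T ≤ 0 := hTS.2
  have hbef : ∀ s ∈ Ioo 0 T, 0 < fML β s := by
    intro s hs
    by_contra hc
    have : s ∈ S := by
      refine ⟨?_, not_lt.1 hc⟩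
      by_contra hc2
      exact hc (hnear s ⟨hs.1, not_le.1 hc2⟩)
    exact absurd (csInf_le hbdd this) (not_le.2 hs.2)
  have hG := Real.Gamma_pos_of_pos hβ
  obtain ⟨δ, hδ0, hδT, hδ⟩ : ∃ δ > 0, δ ≤ T/2 ∧ δ^β ≤ β * Real.Gamma β / 4 := by
    refine ⟨min (T/2) ((β * Real.Gamma β / 4)^(1/β)), by positivity, min_le_left _ _, ?_⟩
    calc _ ≤ ((β * Real.Gamma β / 4)^(1/β))^β :=
          Real.rpow_le_rpow (by positivity) (min_le_right _ _) hβ.le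
      _ = _ := by rw [← Real.rpow_mul (by positivity), one_div_mul_cancel hβ.ne', Real.rpow_one]
  obtain ⟨t, ht, hmax⟩ := isCompact_Icc.exists_isMaxOn (s := Icc (T-δ) T)
    ⟨T, by constructor <;> linarith⟩ ((aux_fcont hβ).mono (fun y hy => by
      have := hy.1
      show 0 < y
      linarith))
  have hmax' : ∀ s ∈ Icc (T-δ) T, fML β s ≤ fML β t := fun s hs => hmax hs
  have ht0 : 0 < t := by linarith [ht.1]
  have hft : 0 < fML β t := lt_of_lt_of_le (hbef (T-δ) ⟨by linarith, by linarith⟩)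
    (hmax' _ ⟨le_rfl, by linarith⟩)
  have htT : t < T := by
    refine lt_of_le_of_ne ht.2 (fun h => ?_)
    rw [h] at hft; linarith
  have hVT := aux_volt hβ hT0
  have hVt := aux_volt hβ ht0
  have hIT := (aux_conv hβ hβ hT0).1
  have hIt := (aux_conv hβ hβ ht0).1
  have hsub1 : Ioo 0 t ⊆ Ioo 0 T := Ioo_subset_Ioo_right htT.le
  have hsub2 : Ioo t T ⊆ Ioo 0 T := Ioo_subset_Ioo_left ht0.le
  have hsplit : ∫ s in Ioo 0 T, (T-s) ^ (β-1) * fML β s =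
      (∫ s in Ioo 0 t, (T-s) ^ (β-1) * fML β s) + ∫ s in Ioo t T, (T-s) ^ (β-1) * fML β s := by
    have hI := (intervalIntegrable_iff_integrableOn_Ioo_of_le (μ := volume) ht0.le).2 (hIT.mono_set hsub1)
    have hI2 := (intervalIntegrable_iff_integrableOn_Ioo_of_le (μ := volume) htT.le).2 (hIT.mono_set hsub2)
    have := intervalIntegral.integral_add_adjacent_intervals hI hI2
    rw [intervalIntegral.integral_of_le ht0.le, intervalIntegral.integral_of_le htT.le,
      intervalIntegral.integral_of_le hT0.le] at this
    simp only [integral_Ioc_eq_integral_Ioo] at this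
    exact this.symm
  have hA : ∫ s in Ioo 0 t, (T-s) ^ (β-1) * fML β s ≤
      ∫ s in Ioo 0 t, (T/t)^(β-1) * ((t-s) ^ (β-1) * fML β s) := by
    apply setIntegral_mono_on (hIT.mono_set hsub1) (hIt.const_mul _) measurableSet_Ioo
    intro s hs
    have hfs := hbef s (hsub1 hs)
    have h1 : 0 < t - s := by linarith [hs.2]
    have h0 := hs.1
    rw [← mul_assoc, ← Real.mul_rpow (by positivity) h1.le]
    apply mul_le_mul_of_nonneg_right _ hfs.le
    apply Real.rpow_le_rpow_of_nonpos (by positivity) _ (by linarith)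
    rw [div_mul_eq_mul_div, div_le_iff₀ ht0]
    nlinarith
  have hB : ∫ s in Ioo t T, (T-s) ^ (β-1) * fML β s ≤
      ∫ s in Ioo t T, (T-s) ^ (β-1) * fML β t := by
    apply setIntegral_mono_on (hIT.mono_set hsub2) ((aux_rint' hβ htT).mul_const _) measurableSet_Ioo
    intro s hs
    have h1 : 0 < T - s := by linarith [hs.2]
    have := hmax' s ⟨by linarith [ht.1, hs.1], hs.2.le⟩
    gcongr
  rw [integral_const_mul, hVt] at hA
  rw [integral_mul_const, aux_rint hβ htT] at hB
  have hK : (T/t)^(β-1) * t^(β-1) = T^(β-1) := by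
    rw [← Real.mul_rpow (by positivity) ht0.le, div_mul_cancel₀ _ ht0.ne']
  have hR : 1/2 ≤ (T/t)^(β-1) := by
    calc (1:ℝ)/2 ≤ (T/t)^(-1:ℝ) := by
          rw [Real.rpow_neg_one, inv_div, div_le_div_iff₀ (by norm_num) hT0]
          linarith [ht.1]
      _ ≤ _ := Real.rpow_le_rpow_of_exponent_le ((one_le_div ht0).2 htT.le) (by linarith)
  have hD : (T-t)^β/β ≤ Real.Gamma β / 4 := by
    have : (T-t)^β ≤ δ^β := Real.rpow_le_rpow (by linarith) (by linarith [ht.1]) hβ.le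
    rw [div_le_iff₀ hβ]; linarith
  have e1 : Real.Gamma β * fML β T ≤ 0 := mul_nonpos_of_nonneg_of_nonpos hG.le hfT
  have e2 : (1/2) * (Real.Gamma β * fML β t) ≤ (T/t)^(β-1) * (Real.Gamma β * fML β t) := by
    gcongr
  have e3 : (T-t)^β/β * fML β t ≤ Real.Gamma β / 4 * fML β t := by gcongr
  have e4 : 0 < Real.Gamma β * fML β t := by positivity
  nlinarith

lemma aux_int {β t : ℝ} (hβ : 0 < β) (ht : 0 < t) : IntegrableOn (fML β) (Ioo 0 t) := by
  simpa using (aux_conv hβ one_pos ht).1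

lemma aux_upper {β t : ℝ} (hβ : 0 < β) (hβ1 : β ≤ 1) (ht : 0 < t) :
    ∫ s in Ioo 0 t, fML β s ≤ 1 := by
  have h := aux_volt hβ ht
  have hG := Real.Gamma_pos_of_pos hβ
  have hp := aux_pos hβ hβ1 ht
  have h1 : ∫ s in Ioo 0 t, t^(β-1) * fML β s ≤ ∫ s in Ioo 0 t, (t-s) ^ (β-1) * fML β s := by
    apply setIntegral_mono_on ((aux_int hβ ht).const_mul _) (aux_conv hβ hβ ht).1 measurableSet_Ioo
    intro s hs
    apply mul_le_mul_of_nonneg_right _ (aux_pos hβ hβ1 hs.1).le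
    exact Real.rpow_le_rpow_of_nonpos (by linarith [hs.2]) (by linarith [hs.1]) (by linarith)
  rw [integral_const_mul, h] at h1
  have hk : 0 < t^(β-1) := by positivity
  have : 0 < Real.Gamma β * fML β t := by positivity
  by_contra hc
  push Not at hc
  nlinarith

lemma aux_lower {β t : ℝ} (hβ : 0 < β) (hβ1 : β ≤ 1) (ht : 0 < t) :
    1 - Real.Gamma (β+1) * t ^ (-β) ≤ ∫ s in Ioo 0 t, fML β s := by
  have h := aux_volt2 hβ ht
  have hG := Real.Gamma_pos_of_pos (add_pos hβ one_pos)
  have hu := aux_upper hβ hβ1 ht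
  have hi := (aux_conv hβ (a := β+1) (by positivity) ht).1
  simp only [add_sub_cancel_right] at hi
  have h1 : ∫ s in Ioo 0 t, (t-s) ^ β * fML β s ≤ ∫ s in Ioo 0 t, t^β * fML β s := by
    apply setIntegral_mono_on hi ((aux_int hβ ht).const_mul _) measurableSet_Ioo
    intro s hs
    apply mul_le_mul_of_nonneg_right _ (aux_pos hβ hβ1 hs.1).le
    exact Real.rpow_le_rpow (by linarith [hs.2]) (by linarith [hs.1]) hβ.le
  rw [integral_const_mul, h] at h1
  have hk : 0 < t^β := by positivity
  rw [Real.rpow_neg ht.le, sub_le_iff_le_add, ← div_eq_mul_inv, ← sub_le_iff_le_add', le_div_iff₀ hk]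
  nlinarith
/-- For `β ∈ (0,1]`, `f_β` is a probability density on `(0,∞)`:
it is nonnegative there and integrates to one. -/
theorem mittagLeffler_density_is_pdf (β : ℝ) (hβ : β ∈ Set.Ioc (0:ℝ) 1) :
    (∀ t : ℝ, 0 < t → 0 ≤ fML β t) ∧ ∫ t in Set.Ioi (0:ℝ), fML β t = 1 := by
  obtain ⟨h0, h1⟩ := hβ
  refine ⟨fun t ht => (aux_pos h0 h1 ht).le, ?_⟩
  have hconv : ∀ t : ℝ, 0 < t → ∫ s in (0:ℝ)..t, fML β s = ∫ s in Ioo 0 t, fML β s := by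
    intro t ht
    rw [intervalIntegral.integral_of_le ht.le, integral_Ioc_eq_integral_Ioo]
  have hint : IntegrableOn (fML β) (Ioi 0) := by
    apply integrableOn_Ioi_of_intervalIntegral_norm_bounded 1 0 (l := atTop)
      (b := fun t : ℝ => max t 1) _ (tendsto_atTop_mono (fun t => le_max_left t 1) tendsto_id)
    · filter_upwards with t
      have ht : 0 < max t 1 := by positivity
      rw [intervalIntegral.integral_of_le ht.le, integral_Ioc_eq_integral_Ioo]
      refine le_trans (le_of_eq ?_) (aux_upper h0 h1 ht)
      apply setIntegral_congr_fun measurableSet_Ioo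
      intro s hs
      exact Real.norm_of_nonneg (aux_pos h0 h1 hs.1).le
    · intro t
      have ht : 0 < max t 1 := by positivity
      rw [integrableOn_Ioc_iff_integrableOn_Ioo]
      exact aux_int h0 ht
  have hlim := intervalIntegral_tendsto_integral_Ioi 0 hint tendsto_id
  refine tendsto_nhds_unique hlim ?_
  have hl : Tendsto (fun t : ℝ => 1 - Real.Gamma (β+1) * t ^ (-β)) atTop (nhds 1) := by
    simpa using ((tendsto_rpow_neg_atTop h0).const_mul (Real.Gamma (β+1))).const_sub 1
  refine tendsto_of_tendsto_of_tendsto_of_le_of_le' hl tendsto_const_nhds ?_ ?_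
  · filter_upwards [eventually_gt_atTop 0] with t ht
    simp only [id, hconv t ht]
    exact aux_lower h0 h1 ht
  · filter_upwards [eventually_gt_atTop 0] with t ht
    simp only [id, hconv t ht]
    exact aux_upper h0 h1 ht
end
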